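/- Sufficiency of unconstrained stationarity: suppose (x̆, μ̆) ∈ ℝ^d × ℝ^d satisfies ∇_x ψ(x̆; μ̆) = 0 and ∇_μ ψ(x̆; μ̆) = 0 (ψ is everywhere differentiable in (x, μ)), and suppose x̆ ∈ 𝒞. Then (x̆, μ̆) is a saddle point: ψ(x; μ̆) ≤ ψ(x̆; μ̆) ≤ ψ(x̆; μ) for all x ∈ 𝒞 and all μ ∈ ℝ^d; consequently ψ(x̆; μ̆) = inf_{μ∈ℝ^d} sup_{x∈𝒞} ψ(x;μ). -/

import Mathlib

open MeasureTheory Real Filter Matrix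

/-- Standard normal density on ℝ. -/
noncomputable def stdPdf (t : ℝ) : ℝ := (Real.sqrt (2 * Real.pi))⁻¹ * Real.exp (-t ^ 2 / 2)

/-- Standard normal cumulative distribution function Φ. -/
noncomputable def Phi (t : ℝ) : ℝ := ∫ s in Set.Iic t, stdPdf s

/-- Standard `d`-dimensional normal density φ_d(x) = (2π)^{-d/2} exp(-‖x‖²/2). -/
noncomputable def phiD {d : ℕ} (x : Fin d → ℝ) : ℝ :=
  ((Real.sqrt (2 * Real.pi)) ^ d)⁻¹ * Real.exp (-(∑ i, x i ^ 2) / 2)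

/-- The sequential bound l̃_k(x) = (l_k − Σ_{j<k} L_{kj} x_j)/L_{kk}
    (and likewise ũ_k(x) upon replacing `l` by `u`). -/
noncomputable def lTil {d : ℕ} (L : Matrix (Fin d) (Fin d) ℝ) (l : Fin d → ℝ)
    (x : Fin d → ℝ) (k : Fin d) : ℝ :=
  (l k - ∑ j ∈ Finset.Iio k, L k j * x j) / L k k

/-- The polytope 𝒞 = {x : l ≤ Lx ≤ u}. -/
def Cset {d : ℕ} (L : Matrix (Fin d) (Fin d) ℝ) (l u : Fin d → ℝ) : Set (Fin d → ℝ) :=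
  {x | ∀ i, l i ≤ L.mulVec x i ∧ L.mulVec x i ≤ u i}

/-- ψ(x;μ) = −xᵀμ + ‖μ‖²/2 + Σ_k log(Φ(ũ_k(x) − μ_k) − Φ(l̃_k(x) − μ_k)). -/
noncomputable def psi {d : ℕ} (L : Matrix (Fin d) (Fin d) ℝ) (l u : Fin d → ℝ)
    (x μ : Fin d → ℝ) : ℝ :=
  -(∑ i, x i * μ i) + (∑ i, μ i ^ 2) / 2 +
    ∑ k, Real.log (Phi (lTil L u x k - μ k) - Phi (lTil L l x k - μ k))

/-- Sequential importance-sampling density g(x;μ). -/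
noncomputable def gdens {d : ℕ} (L : Matrix (Fin d) (Fin d) ℝ) (l u : Fin d → ℝ)
    (x μ : Fin d → ℝ) : ℝ :=
  ∏ k, stdPdf (x k - μ k) *
      (if lTil L l x k ≤ x k ∧ x k ≤ lTil L u x k then (1 : ℝ) else 0) /
      (Phi (lTil L u x k - μ k) - Phi (lTil L l x k - μ k))

/-- ℓ = ∫_𝒞 φ_d(x) dx. -/
noncomputable def lval {d : ℕ} (L : Matrix (Fin d) (Fin d) ℝ) (l u : Fin d → ℝ) : ℝ :=
  ∫ x in Cset L l u, phiD x

lemma stdPdf_pos (t : ℝ) : 0 < stdPdf t := by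
  unfold stdPdf
  positivity

lemma integrable_stdPdf : Integrable stdPdf := by
  have h := ProbabilityTheory.integrable_gaussianPDFReal 0 1
  convert h using 1
  ext t
  simp [stdPdf, ProbabilityTheory.gaussianPDFReal]

lemma hasDerivAt_stdPdf (t : ℝ) : HasDerivAt stdPdf (-t * stdPdf t) t := by
  have h : HasDerivAt (fun s : ℝ => -s ^ 2 / 2) (-t) t := by
    refine ((hasDerivAt_pow 2 t).neg.div_const 2).congr_deriv ?_
    norm_num
    ring
  refine (h.exp.const_mul (Real.sqrt (2 * Real.pi))⁻¹).congr_deriv ?_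
  unfold stdPdf
  ring

lemma continuous_stdPdf : Continuous stdPdf :=
  continuous_iff_continuousAt.2 fun t => (hasDerivAt_stdPdf t).continuousAt

lemma hasDerivAt_Phi (t : ℝ) : HasDerivAt Phi (stdPdf t) t := by
  have h : Phi = fun s => (∫ x in (0 : ℝ)..s, stdPdf x) + Phi 0 := by
    ext s
    rw [← intervalIntegral.integral_Iic_sub_Iic integrable_stdPdf.integrableOn
      integrable_stdPdf.integrableOn]
    simp [Phi]
  rw [h]
  exact (intervalIntegral.integral_hasDerivAt_right
    (continuous_stdPdf.intervalIntegrable _ _)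
    continuous_stdPdf.aestronglyMeasurable.stronglyMeasurableAtFilter
    continuous_stdPdf.continuousAt).add_const _

lemma continuous_Phi : Continuous Phi :=
  continuous_iff_continuousAt.2 fun t => (hasDerivAt_Phi t).continuousAt

lemma strictMono_Phi : StrictMono Phi :=
  strictMono_of_hasDerivAt_pos hasDerivAt_Phi stdPdf_pos

/-- A function with nonnegative derivative on `[a, b]` does not decrease from `a` to `b`. -/
lemma le_of_hasDerivAt_nonneg {F F' : ℝ → ℝ} {a b : ℝ} (hab : a ≤ b)
    (hF : ∀ t, HasDerivAt F (F' t) t) (hF' : ∀ t, a ≤ t → t ≤ b → 0 ≤ F' t) : F a ≤ F b := by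
  refine monotoneOn_of_deriv_nonneg (convex_Icc a b)
    (fun t _ => (hF t).continuousAt.continuousWithinAt)
    (fun t _ => (hF t).differentiableAt.differentiableWithinAt) (fun t ht => ?_)
    (Set.left_mem_Icc.2 hab) (Set.right_mem_Icc.2 hab) hab
  rw [interior_Icc] at ht
  rw [(hF t).deriv]
  exact hF' t ht.1.le ht.2.le

lemma left_mul_Phi_sub_le {a b : ℝ} (hab : a ≤ b) :
    a * (Phi b - Phi a) ≤ stdPdf a - stdPdf b := by
  have h := le_of_hasDerivAt_nonneg hab
    (fun t => ((hasDerivAt_stdPdf t).neg.sub ((hasDerivAt_Phi t).const_mul a)))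
    (fun t hat _ => by nlinarith [mul_nonneg (sub_nonneg.2 hat) (stdPdf_pos t).le])
  simp only [Pi.sub_apply, Pi.neg_apply] at h
  linarith

lemma le_right_mul_Phi_sub {a b : ℝ} (hab : a ≤ b) :
    stdPdf a - stdPdf b ≤ b * (Phi b - Phi a) := by
  have h := le_of_hasDerivAt_nonneg hab
    (fun t => (((hasDerivAt_Phi t).const_mul b).add (hasDerivAt_stdPdf t)))
    (fun t _ htb => by nlinarith [mul_nonneg (sub_nonneg.2 htb) (stdPdf_pos t).le])
  simp only [Pi.add_apply] at h
  linarith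

/-- Nonnegativity of the second moment of a truncated standard normal about `m`. -/
lemma truncated_second_moment_nonneg {a b : ℝ} (hab : a ≤ b) (m : ℝ) :
    0 ≤ (1 + m ^ 2) * (Phi b - Phi a) + (a * stdPdf a - b * stdPdf b)
      - 2 * m * (stdPdf a - stdPdf b) := by
  have h := le_of_hasDerivAt_nonneg hab
    (fun t => ((((hasDerivAt_Phi t).const_mul (1 + m ^ 2)).sub
      ((hasDerivAt_id t).mul (hasDerivAt_stdPdf t))).add
      ((hasDerivAt_stdPdf t).const_mul (2 * m))))
    (fun t _ _ => by
      have := mul_nonneg (sq_nonneg (t - m)) (stdPdf_pos t).le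
      simp only [id]
      nlinarith)
  simp only [Pi.add_apply, Pi.sub_apply, Pi.mul_apply, id] at h
  linarith

/-- The logarithm of the mass that the normal law with mean `t` and unit variance
gives to the interval `[a, b]`. -/
noncomputable def logMass (a b t : ℝ) : ℝ := Real.log (Phi (b - t) - Phi (a - t))

lemma Phi_shift_sub_pos {a b : ℝ} (hab : a < b) (t : ℝ) : 0 < Phi (b - t) - Phi (a - t) :=
  sub_pos.2 (strictMono_Phi (by linarith))

lemma hasDerivAt_Phi_shift_sub (a b t : ℝ) :
    HasDerivAt (fun s => Phi (b - s) - Phi (a - s)) (stdPdf (a - t) - stdPdf (b - t)) t := by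
  have h (c : ℝ) : HasDerivAt (fun s => Phi (c - s)) (-stdPdf (c - t)) t :=
    (hasDerivAt_Phi (c - t)).comp_const_sub c t
  exact ((h b).sub (h a)).congr_deriv (by ring)

lemma hasDerivAt_stdPdf_shift_sub (a b t : ℝ) :
    HasDerivAt (fun s => stdPdf (a - s) - stdPdf (b - s))
      ((a - t) * stdPdf (a - t) - (b - t) * stdPdf (b - t)) t := by
  have h (c : ℝ) : HasDerivAt (fun s => stdPdf (c - s)) (-(-(c - t) * stdPdf (c - t))) t :=
    (hasDerivAt_stdPdf (c - t)).comp_const_sub c t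
  exact ((h a).sub (h b)).congr_deriv (by ring)

lemma hasDerivAt_logMass {a b : ℝ} (hab : a < b) (t : ℝ) :
    HasDerivAt (logMass a b)
      ((stdPdf (a - t) - stdPdf (b - t)) / (Phi (b - t) - Phi (a - t))) t :=
  (hasDerivAt_Phi_shift_sub a b t).log (Phi_shift_sub_pos hab t).ne'

lemma hasDerivAt_deriv_logMass {a b : ℝ} (hab : a < b) (t : ℝ) :
    HasDerivAt (fun s => (stdPdf (a - s) - stdPdf (b - s)) / (Phi (b - s) - Phi (a - s)))
      ((((a - t) * stdPdf (a - t) - (b - t) * stdPdf (b - t)) * (Phi (b - t) - Phi (a - t))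
        - (stdPdf (a - t) - stdPdf (b - t)) * (stdPdf (a - t) - stdPdf (b - t)))
        / (Phi (b - t) - Phi (a - t)) ^ 2) t :=
  (hasDerivAt_stdPdf_shift_sub a b t).div (hasDerivAt_Phi_shift_sub a b t)
    (Phi_shift_sub_pos hab t).ne'

lemma concaveOn_logMass {a b : ℝ} (hab : a < b) : ConcaveOn ℝ Set.univ (logMass a b) := by
  refine concaveOn_of_hasDerivWithinAt2_nonpos convex_univ
    (fun t _ => (hasDerivAt_logMass hab t).continuousAt.continuousWithinAt)
    (fun t _ => (hasDerivAt_logMass hab t).hasDerivWithinAt)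
    (fun t _ => (hasDerivAt_deriv_logMass hab t).hasDerivWithinAt) (fun t _ => ?_)
  have hle : a - t ≤ b - t := by linarith
  refine div_nonpos_of_nonpos_of_nonneg ?_ (sq_nonneg _)
  have h₁ := mul_nonneg (sub_nonneg.2 (left_mul_Phi_sub_le hle)) (stdPdf_pos (a - t)).le
  have h₂ := mul_nonneg (sub_nonneg.2 (le_right_mul_Phi_sub hle)) (stdPdf_pos (b - t)).le
  nlinarith

lemma convexOn_half_sq_add_logMass {a b : ℝ} (hab : a < b) :
    ConvexOn ℝ Set.univ (fun t => t ^ 2 / 2 + logMass a b t) := by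
  have hsq (t : ℝ) : HasDerivAt (fun s : ℝ => s ^ 2 / 2) t t := by
    exact ((hasDerivAt_pow 2 t).div_const 2).congr_deriv (by norm_num)
  have h₁ (t : ℝ) := (hsq t).add (hasDerivAt_logMass hab t)
  have h₂ (t : ℝ) := (hasDerivAt_id t).add (hasDerivAt_deriv_logMass hab t)
  refine convexOn_of_hasDerivWithinAt2_nonneg convex_univ
    (fun t _ => (h₁ t).continuousAt.continuousWithinAt)
    (fun t _ => (h₁ t).hasDerivWithinAt) (fun t _ => (h₂ t).hasDerivWithinAt) (fun t _ => ?_)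
  have hf := Phi_shift_sub_pos hab t
  have hm := truncated_second_moment_nonneg (show a - t ≤ b - t by linarith)
    ((stdPdf (a - t) - stdPdf (b - t)) / (Phi (b - t) - Phi (a - t)))
  have key := div_nonneg hm hf.le
  refine key.trans_eq ?_
  field_simp
  ring

/-- A critical point of a convex function is a global minimizer. -/
lemma ConvexOn.le_of_hasFDerivAt_zero {E : Type*} [NormedAddCommGroup E] [NormedSpace ℝ E]
    {F : E → ℝ} (hF : ConvexOn ℝ Set.univ F) {x : E}
    (hx : HasFDerivAt F (0 : E →L[ℝ] ℝ) x) (y : E) : F x ≤ F y := by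
  have hconv : ConvexOn ℝ Set.univ (F ∘ AffineMap.lineMap (k := ℝ) x y) :=
    hF.comp_affineMap (AffineMap.lineMap x y)
  have hline : HasDerivAt (AffineMap.lineMap (k := ℝ) x y) (y - x) (0 : ℝ) :=
    AffineMap.hasDerivAt_lineMap
  have hder : HasDerivAt (F ∘ AffineMap.lineMap (k := ℝ) x y) 0 (0 : ℝ) := by
    have hx' : HasFDerivAt F (0 : E →L[ℝ] ℝ) (AffineMap.lineMap (k := ℝ) x y 0) := by
      simpa using hx
    simpa using hx'.comp_hasDerivAt (0 : ℝ) hline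
  have h := hconv.le_slope_of_hasDerivAt (Set.mem_univ _) (Set.mem_univ _) zero_lt_one hder
  simpa [slope_def_field] using h

section Psi

variable {d : ℕ} (L : Matrix (Fin d) (Fin d) ℝ)

lemma psi_eq_sum (l u x μ : Fin d → ℝ) :
    psi L l u x μ = ∑ k, (-(x k * μ k) +
      (μ k ^ 2 / 2 + logMass (lTil L l x k) (lTil L u x k) (μ k))) := by
  simp only [psi, logMass, Finset.sum_add_distrib, Finset.sum_neg_distrib, Finset.sum_div]
  ring

lemma lTil_lt_lTil (hDiag : ∀ i, 0 < L i i) {l u : Fin d → ℝ} (hlu : ∀ k, l k < u k)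
    (x : Fin d → ℝ) (k : Fin d) : lTil L l x k < lTil L u x k :=
  div_lt_div_of_pos_right (by linarith [hlu k]) (hDiag k)

/-- The linear functional by which conditioning on `x` shifts the `k`-th pair of bounds. -/
noncomputable def boundShift (k : Fin d) : (Fin d → ℝ) →ₗ[ℝ] ℝ :=
  (L k k)⁻¹ • ∑ j ∈ Finset.Iio k, L k j • LinearMap.proj j

lemma lTil_eq_sub_boundShift (l x : Fin d → ℝ) (k : Fin d) :
    lTil L l x k = l k / L k k - boundShift L k x := by
  simp [lTil, boundShift, div_eq_inv_mul, mul_sub]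

lemma convexOn_psi_right (hDiag : ∀ i, 0 < L i i) {l u : Fin d → ℝ} (hlu : ∀ k, l k < u k)
    (x : Fin d → ℝ) : ConvexOn ℝ Set.univ (fun μ => psi L l u x μ) := by
  simp only [psi_eq_sum]
  have hlin (k : Fin d) : ConvexOn ℝ Set.univ (fun μ : Fin d → ℝ => -(x k * μ k)) := by
    refine ((-(x k) • LinearMap.proj (R := ℝ) (φ := fun _ : Fin d => ℝ) k).convexOn
      convex_univ).congr fun y _ => ?_
    simp [mul_comm]
  have hmass (k : Fin d) : ConvexOn ℝ Set.univ (fun μ : Fin d → ℝ =>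
      μ k ^ 2 / 2 + logMass (lTil L l x k) (lTil L u x k) (μ k)) :=
    (convexOn_half_sq_add_logMass (lTil_lt_lTil L hDiag hlu x k)).comp_linearMap
      (LinearMap.proj (R := ℝ) (φ := fun _ : Fin d => ℝ) k)
  have h := Finset.sum_induction (s := Finset.univ)
    (fun k (μ : Fin d → ℝ) => -(x k * μ k) +
      (μ k ^ 2 / 2 + logMass (lTil L l x k) (lTil L u x k) (μ k)))
    (ConvexOn ℝ Set.univ) (fun _ _ => ConvexOn.add) (convexOn_const 0 convex_univ)
    (fun k _ => (hlin k).add (hmass k))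
  convert h using 1
  ext μ
  simp

lemma concaveOn_psi_left (hDiag : ∀ i, 0 < L i i) {l u : Fin d → ℝ} (hlu : ∀ k, l k < u k)
    (μ : Fin d → ℝ) : ConcaveOn ℝ Set.univ (fun x => psi L l u x μ) := by
  simp only [psi_eq_sum]
  have hlin (k : Fin d) : ConcaveOn ℝ Set.univ (fun x : Fin d → ℝ => -(x k * μ k)) := by
    refine ((-(μ k) • LinearMap.proj (R := ℝ) (φ := fun _ : Fin d => ℝ) k).concaveOn
      convex_univ).congr fun y _ => ?_
    simp [mul_comm]
  have hmass (k : Fin d) : ConcaveOn ℝ Set.univ (fun x : Fin d → ℝ =>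
      logMass (lTil L l x k) (lTil L u x k) (μ k)) := by
    have hlt : l k / L k k < u k / L k k := div_lt_div_of_pos_right (hlu k) (hDiag k)
    have h := ((concaveOn_logMass hlt).translate_right (μ k)).comp_linearMap (boundShift L k)
    simp only [Set.preimage_univ] at h
    refine h.congr fun x _ => ?_
    simp [logMass, lTil_eq_sub_boundShift, sub_sub, add_comm]
  have h := Finset.sum_induction (s := Finset.univ)
    (fun k (x : Fin d → ℝ) => -(x k * μ k) +
      (μ k ^ 2 / 2 + logMass (lTil L l x k) (lTil L u x k) (μ k)))
    (ConcaveOn ℝ Set.univ) (fun _ _ => ConcaveOn.add) (concaveOn_const 0 convex_univ)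
    (fun k _ => (hlin k).add ((concaveOn_const _ convex_univ).add (hmass k)))
  convert h using 1
  ext x
  simp

lemma continuous_psi_left (hDiag : ∀ i, 0 < L i i) {l u : Fin d → ℝ} (hlu : ∀ k, l k < u k)
    (μ : Fin d → ℝ) : Continuous (fun x => psi L l u x μ) := by
  have hL (v : Fin d → ℝ) (k : Fin d) : Continuous (fun x => lTil L v x k) := by
    unfold lTil
    fun_prop
  unfold psi
  refine (by fun_prop : Continuous fun x : Fin d → ℝ =>
    -(∑ i, x i * μ i) + (∑ i, μ i ^ 2) / 2).add (continuous_finsetSum _ fun k _ => ?_)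
  refine Continuous.log ?_ fun x => (Phi_shift_sub_pos (lTil_lt_lTil L hDiag hlu x k) (μ k)).ne'
  exact (continuous_Phi.comp ((hL u k).sub continuous_const)).sub
    (continuous_Phi.comp ((hL l k).sub continuous_const))

lemma isCompact_Cset (hLow : ∀ i j : Fin d, i < j → L i j = 0) (hDiag : ∀ i, 0 < L i i)
    (l u : Fin d → ℝ) : IsCompact (Cset L l u) := by
  have hdet : IsUnit L.det := by
    rw [Matrix.det_of_isLowerTriangular L fun i j hij => hLow i j hij]
    exact (Finset.prod_pos fun i _ => hDiag i).ne'.isUnit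
  have himg : Cset L l u = (fun y => L⁻¹ *ᵥ y) '' Set.Icc l u := by
    ext x
    constructor
    · intro hx
      exact ⟨L *ᵥ x, ⟨fun i => (hx i).1, fun i => (hx i).2⟩, by
        simp [Matrix.mulVec_mulVec, Matrix.nonsing_inv_mul L hdet]⟩
    · rintro ⟨y, hy, rfl⟩ i
      have : L *ᵥ (L⁻¹ *ᵥ y) = y := by
        simp [Matrix.mulVec_mulVec, Matrix.mul_nonsing_inv L hdet]
      simp only [this]
      exact ⟨hy.1 i, hy.2 i⟩
  rw [himg]
  exact isCompact_Icc.image (by fun_prop)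

end Psi

/-- sufficiency of unconstrained stationarity. If ψ has vanishing gradient in x
and in μ at (x̆, μ̆) and x̆ ∈ 𝒞, then (x̆, μ̆) is a saddle point of ψ on 𝒞 × ℝ^d and
ψ(x̆;μ̆) = inf_μ sup_{x∈𝒞} ψ(x;μ). -/
theorem stationarity_sufficient {d : ℕ} (hd : 1 ≤ d)
    (L : Matrix (Fin d) (Fin d) ℝ)
    (hLow : ∀ i j : Fin d, i < j → L i j = 0)
    (hDiag : ∀ i, 0 < L i i)
    (l u : Fin d → ℝ) (hlu : ∀ k, l k < u k)
    (xb μb : Fin d → ℝ)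
    (hx : xb ∈ Cset L l u)
    (hdx : HasFDerivAt (fun x => psi L l u x μb) (0 : (Fin d → ℝ) →L[ℝ] ℝ) xb)
    (hdμ : HasFDerivAt (fun μ => psi L l u xb μ) (0 : (Fin d → ℝ) →L[ℝ] ℝ) μb) :
    (∀ x ∈ Cset L l u, psi L l u x μb ≤ psi L l u xb μb) ∧
    (∀ μ : Fin d → ℝ, psi L l u xb μb ≤ psi L l u xb μ) ∧
    psi L l u xb μb = ⨅ μ : Fin d → ℝ, sSup ((fun x => psi L l u x μ) '' Cset L l u) := by
  have hmax (x : Fin d → ℝ) : psi L l u x μb ≤ psi L l u xb μb := by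
    have hneg : HasFDerivAt (-fun x => psi L l u x μb) (0 : (Fin d → ℝ) →L[ℝ] ℝ) xb := by
      simpa using hdx.neg
    have h := (concaveOn_psi_left L hDiag hlu μb).neg.le_of_hasFDerivAt_zero hneg x
    exact neg_le_neg_iff.1 h
  have hmin := (convexOn_psi_right L hDiag hlu xb).le_of_hasFDerivAt_zero hdμ
  have hle (μ : Fin d → ℝ) :
      psi L l u xb μb ≤ sSup ((fun x => psi L l u x μ) '' Cset L l u) :=
    (hmin μ).trans <| le_csSup
      ((isCompact_Cset L hLow hDiag l u).bddAbove_image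
        (continuous_psi_left L hDiag hlu μ).continuousOn) ⟨xb, hx, rfl⟩
  refine ⟨fun x _ => hmax x, hmin, le_antisymm (le_ciInf hle) ?_⟩
  refine (ciInf_le ⟨_, Set.forall_mem_range.2 hle⟩ μb).trans (csSup_le ⟨_, xb, hx, rfl⟩ ?_)
  rintro _ ⟨x, _, rfl⟩
  exact hmax x
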